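/- arXiv:2103.12113 — 2 statements merged into one kernel-verified Lean document; each statement's English description precedes it below -/
import Mathlib

section
/- Suppose 1, θ₁, …, θₙ are linearly independent over ℚ, ω < ∞, and λ̂ < 1. Then (1 + λ)/(1 + ω^{−1}) ≥ (1 − ω̂^{−1})/(1 − λ̂). -/
open scoped ENNReal


/-- Solvability of the simultaneous approximation system
`max_{1≤i≤n} |x₀θᵢ - xᵢ| ≤ t^{-γ}`, `0 < |x₀| ≤ t` in integers. -/
def SimSolvable (n : ℕ) (θ : Fin n → ℝ) (γ t : ℝ) : Prop :=
  ∃ x : Fin (n+1) → ℤ, x 0 ≠ 0 ∧ (|x 0| : ℝ) ≤ t ∧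
    ∀ i : Fin n, |(x 0 : ℝ) * θ i - (x i.succ : ℝ)| ≤ t ^ (-γ)

/-- Solvability of the linear form system
`|x₀ + θ₁x₁ + … + θₙxₙ| ≤ t^{-γ}`, `0 < max_{1≤i≤n} |xᵢ| ≤ t` in integers. -/
def LinSolvable (n : ℕ) (θ : Fin n → ℝ) (γ t : ℝ) : Prop :=
  ∃ x : Fin (n+1) → ℤ, (∃ i : Fin n, x i.succ ≠ 0) ∧ (∀ i : Fin n, (|x i.succ| : ℝ) ≤ t) ∧
    |(x 0 : ℝ) + ∑ i : Fin n, θ i * (x i.succ : ℝ)| ≤ t ^ (-γ)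

/-- The regular simultaneous Diophantine exponent `λ(θ) ∈ [0,∞]`. -/
noncomputable def lambdaExp (n : ℕ) (θ : Fin n → ℝ) : ℝ≥0∞ :=
  sSup {e : ℝ≥0∞ | ∃ γ : ℝ, 0 < γ ∧ e = ENNReal.ofReal γ ∧
    ∀ T : ℝ, ∃ t : ℝ, T < t ∧ SimSolvable n θ γ t}

/-- The uniform simultaneous Diophantine exponent `λ̂(θ) ∈ [0,∞]`. -/
noncomputable def lambdaHatExp (n : ℕ) (θ : Fin n → ℝ) : ℝ≥0∞ :=
  sSup {e : ℝ≥0∞ | ∃ γ : ℝ, 0 < γ ∧ e = ENNReal.ofReal γ ∧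
    ∃ T : ℝ, ∀ t : ℝ, T < t → SimSolvable n θ γ t}

/-- The regular linear form Diophantine exponent `ω(θ) ∈ [0,∞]`. -/
noncomputable def omegaExp (n : ℕ) (θ : Fin n → ℝ) : ℝ≥0∞ :=
  sSup {e : ℝ≥0∞ | ∃ γ : ℝ, 0 < γ ∧ e = ENNReal.ofReal γ ∧
    ∀ T : ℝ, ∃ t : ℝ, T < t ∧ LinSolvable n θ γ t}

/-- The uniform linear form Diophantine exponent `ω̂(θ) ∈ [0,∞]`. -/
noncomputable def omegaHatExp (n : ℕ) (θ : Fin n → ℝ) : ℝ≥0∞ :=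
  sSup {e : ℝ≥0∞ | ∃ γ : ℝ, 0 < γ ∧ e = ENNReal.ofReal γ ∧
    ∃ T : ℝ, ∀ t : ℝ, T < t → LinSolvable n θ γ t}

open Filter Topology

/-- Orthogonality trick: if `|x₀ L(y)| ≤ 1/2` then `|x₀ L(y)|` is controlled by the product of the
height of `y` and the approximation quality of `x`, because `⟨x, y⟩` is an integer. -/
lemma abs_mul_linForm_le {n : ℕ} {θ : Fin n → ℝ} {x y : Fin (n+1) → ℤ} {ℓ η : ℝ} (hη : 0 ≤ η)
    (hx : ∀ i : Fin n, |(x 0 : ℝ) * θ i - (x i.succ : ℝ)| ≤ ℓ)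
    (hy : ∀ i : Fin n, |(y i.succ : ℝ)| ≤ η)
    (hxy : |(x 0 : ℝ)| * |(y 0 : ℝ) + ∑ i : Fin n, θ i * (y i.succ : ℝ)| ≤ 1 / 2) :
    |(x 0 : ℝ)| * |(y 0 : ℝ) + ∑ i : Fin n, θ i * (y i.succ : ℝ)| ≤ n * (η * ℓ) := by
  set M : ℝ := (y 0 : ℝ) + ∑ i : Fin n, θ i * (y i.succ : ℝ) with hM
  set S : ℝ := ∑ i : Fin n, ((x 0 : ℝ) * θ i - (x i.succ : ℝ)) * (y i.succ : ℝ) with hS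
  have hSle : |S| ≤ n * (η * ℓ) := by
    calc |S| ≤ ∑ i : Fin n, |((x 0 : ℝ) * θ i - (x i.succ : ℝ)) * (y i.succ : ℝ)| :=
          Finset.abs_sum_le_sum_abs _ _
      _ ≤ ∑ _i : Fin n, η * ℓ := by
          refine Finset.sum_le_sum fun i _ => ?_
          rw [abs_mul, mul_comm]
          exact mul_le_mul (hy i) (hx i) (abs_nonneg _) hη
      _ = n * (η * ℓ) := by simp
  have hid : (x 0 : ℝ) * M = ((x 0 * y 0 + ∑ i : Fin n, x i.succ * y i.succ : ℤ) : ℝ) + S := by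
    push_cast
    rw [hM, hS, mul_add, Finset.mul_sum, add_assoc, ← Finset.sum_add_distrib]
    congr 1
    exact Finset.sum_congr rfl fun i _ => by ring
  rw [← abs_mul] at hxy ⊢
  generalize (x 0 * y 0 + ∑ i : Fin n, x i.succ * y i.succ : ℤ) = z at hid
  rcases eq_or_ne z 0 with hz | hz
  · rw [hid, hz]
    simpa using hSle
  · have h1 : (1 : ℝ) ≤ |(z : ℝ)| := by exact_mod_cast Int.one_le_abs hz
    have h2 : (z : ℝ) = x 0 * M - S := by linarith
    have h3 := abs_sub ((x 0 : ℝ) * M) S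
    rw [← h2] at h3
    linarith

/-- The linear inequalities satisfied by the logarithms are incompatible with large heights. -/
lemma log_height_le {lam om h w a m C : ℝ} (hlam : 0 ≤ lam) (hom : 0 < om)
    (hw : 1 < w) (ha : 0 ≤ a)
    (hlt : (1 - h) / (1 + om⁻¹) < (1 - w⁻¹) / (1 + lam))
    (h1 : h * m ≤ lam * a) (h2 : m ≤ om * (a / w)) (h3 : (1 - w⁻¹) * a ≤ (1 - h) * m + C) :
    m ≤ |C| / ((1 - w⁻¹) / (1 + lam) - (1 - h) / (1 + om⁻¹)) := by
  have hw0 : 0 < w⁻¹ := by positivity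
  have hw1 : w⁻¹ < 1 := inv_lt_one_of_one_lt₀ hw
  have hom' : 0 < om⁻¹ := by positivity
  set α := (1 - w⁻¹) / (1 + lam) with hα
  set β := (1 - h) / (1 + om⁻¹) with hβ
  have hα0 : 0 < α := div_pos (by linarith) (by linarith)
  have hα1 : α < 1 := by rw [hα, div_lt_one (by linarith)]; linarith
  have eα : α * (1 + lam) = 1 - w⁻¹ := div_mul_cancel₀ _ (by positivity)
  have eβ : β * (1 + om⁻¹) = 1 - h := div_mul_cancel₀ _ (by positivity)
  have hb : om⁻¹ * m ≤ w⁻¹ * a := by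
    rw [inv_mul_le_iff₀ hom]
    calc m ≤ om * (a / w) := h2
      _ = _ := by ring
  rw [le_div_iff₀ (by linarith)]
  have hC := le_abs_self C
  have hC0 := abs_nonneg C
  rcases le_or_gt m 0 with hm | hm
  · nlinarith
  have hA : α * (a + h * m) ≤ (1 - w⁻¹) * a := by
    rw [← eα, mul_assoc]
    exact mul_le_mul_of_nonneg_left (by linarith) hα0.le
  have hB : (α - β) * m ≤ (α - β) * (w⁻¹ * a + m) :=
    mul_le_mul_of_nonneg_left (by nlinarith) (by linarith)
  rcases le_or_gt β 0 with hβ0 | hβ0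
  · have : 0 ≤ (1 - h) * m + C := le_trans (mul_nonneg (by linarith) ha) h3
    have h5 : (1 - h) * m ≤ β * m := by rw [← eβ]; nlinarith [mul_nonneg hom'.le hm.le]
    nlinarith [mul_nonneg (sub_nonneg.2 hα1.le) hC0]
  · have hBm : (1 - h) * m ≤ β * (w⁻¹ * a + m) := by
      rw [← eβ, mul_assoc]
      exact mul_le_mul_of_nonneg_left (by linarith) hβ0.le
    nlinarith [mul_nonneg (sub_nonneg.2 hα1.le) hC0]

/-- The transference inequality in terms of real exponents for which solvability is known. -/
lemma exponent_transference {n : ℕ} {θ : Fin n → ℝ} {lam om h w : ℝ}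
    (hlam : 0 < lam) (hom : 0 < om) (hh : 0 ≤ h) (hw : 1 < w)
    (hS : ∀ᶠ t in atTop, ¬ SimSolvable n θ lam t)
    (hL : ∀ᶠ t in atTop, ¬ LinSolvable n θ om t)
    (hS' : ∀ K : ℝ, ∀ᶠ t in atTop, ∃ x : Fin (n+1) → ℤ, K ≤ |(x 0 : ℝ)| ∧ |(x 0 : ℝ)| ≤ t ∧
      ∀ i : Fin n, |(x 0 : ℝ) * θ i - (x i.succ : ℝ)| ≤ t ^ (-h))
    (hL' : ∀ᶠ t in atTop, LinSolvable n θ w t) :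
    (1 - w⁻¹) / (1 + lam) ≤ (1 - h) / (1 + om⁻¹) := by
  by_contra! hlt
  set C : ℝ := Real.log n + 2 * Real.log 2
  set D := |C| / ((1 - w⁻¹) / (1 + lam) - (1 - h) / (1 + om⁻¹)) with hD
  have hw0 : 0 < w := by linarith
  have hη : Tendsto (fun X : ℝ => (2 * X) ^ w⁻¹) atTop atTop :=
    (tendsto_rpow_atTop (by positivity)).comp (tendsto_id.const_mul_atTop two_pos)
  obtain ⟨K, hK⟩ := eventually_atTop.1 ((eventually_ge_atTop (1 : ℝ)).and (hS.and
    ((hη.eventually hL).and ((hη.eventually hL').and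
      (Real.tendsto_log_atTop.eventually_gt_atTop D)))))
  obtain ⟨T, hT⟩ := eventually_atTop.1 (hS' (max K 1))
  have hMpos : ∀ y : Fin (n+1) → ℤ, (∃ i : Fin n, y i.succ ≠ 0) →
      0 < |(y 0 : ℝ) + ∑ i : Fin n, θ i * (y i.succ : ℝ)| := by
    rintro y hy
    by_contra! hM
    obtain ⟨t, ht, ht0, htn⟩ := (((eventually_all.2 fun i : Fin n =>
      eventually_ge_atTop |(y i.succ : ℝ)|).and ((eventually_ge_atTop (0 : ℝ)).and hL)).exists)
    exact htn ⟨y, hy, ht, hM.trans (Real.rpow_nonneg ht0 _)⟩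
  obtain ⟨ε, hε0, hεT⟩ : ∃ ε : ℝ, 0 < ε ∧ T ≤ (2 * ε)⁻¹ := by
    refine ⟨(2 * max T 1)⁻¹, by positivity, ?_⟩
    have : (2 * (2 * max T 1)⁻¹)⁻¹ = max T 1 := by field_simp
    rw [this]
    exact le_max_left _ _
  have hex : ∃ N : ℕ, ∃ y : Fin (n+1) → ℤ, (∃ i : Fin n, y i.succ ≠ 0) ∧
      (∀ i : Fin n, |(y i.succ : ℝ)| ≤ N) ∧
      |(y 0 : ℝ) + ∑ i : Fin n, θ i * (y i.succ : ℝ)| ≤ ε := by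
    obtain ⟨t, ⟨y, hy, hyt, hyM⟩, ht⟩ := (hL'.and
      ((tendsto_rpow_neg_atTop hw0).eventually (ge_mem_nhds hε0))).exists
    exact ⟨⌈t⌉₊, y, hy, fun i => (hyt i).trans (Nat.le_ceil t), hyM.trans ht⟩
  classical
  obtain ⟨y, hy, hyN, hyε⟩ := Nat.find_spec hex
  have hmin := fun N : ℕ => Nat.find_min hex (m := N)
  set N := Nat.find hex
  set M := |(y 0 : ℝ) + ∑ i : Fin n, θ i * (y i.succ : ℝ)| with hM
  have hM0 : 0 < M := hMpos y hy
  obtain ⟨x, hxK, hxM, hxL⟩ := hT (2 * M)⁻¹ (hεT.trans (by gcongr))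
  obtain ⟨hX1, hSX, hLX, hLX', hDX⟩ := hK _ ((le_max_left _ _).trans hxK)
  set X := |(x 0 : ℝ)| with hX
  have hX0 : 0 < X := by linarith
  rw [Real.inv_rpow (by positivity), Real.rpow_neg (by positivity), inv_inv] at hxL
  rw [le_inv_comm₀ hX0 (by positivity)] at hxM
  obtain ⟨z, hz, hzη, hzX, hzL⟩ : ∃ z : Fin (n+1) → ℤ, (∃ i : Fin n, z i.succ ≠ 0) ∧
      (∀ i : Fin n, |(z i.succ : ℝ)| ≤ (2 * X) ^ w⁻¹) ∧
      2 * |(z 0 : ℝ) + ∑ i : Fin n, θ i * (z i.succ : ℝ)| ≤ X⁻¹ ∧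
      ∀ i : Fin n, |(x 0 : ℝ) * θ i - (x i.succ : ℝ)| ≤
        (2 * |(z 0 : ℝ) + ∑ i : Fin n, θ i * (z i.succ : ℝ)|) ^ h := by
    rcases le_or_gt (N : ℝ) ((2 * X) ^ w⁻¹) with hN | hN
    · exact ⟨y, hy, fun i => (hyN i).trans hN, hxM, hxL⟩
    · obtain ⟨z, hz, hzη, hzM⟩ := hLX'
      refine ⟨z, hz, hzη, ?_, fun i => (hxL i).trans ?_⟩
      · rw [← Real.rpow_mul (by positivity), mul_neg, inv_mul_cancel₀ hw0.ne',
          Real.rpow_neg_one, mul_inv] at hzM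
        linarith
      · refine Real.rpow_le_rpow (by positivity) ?_ hh
        by_contra! hlt'
        refine hmin ⌊(2 * X) ^ w⁻¹⌋₊ ((Nat.floor_lt (by positivity)).2 hN)
          ⟨z, hz, fun i => ?_, by linarith⟩
        rw [← Int.cast_abs, Int.abs_eq_natAbs, Int.cast_natCast, Nat.cast_le]
        refine Nat.le_floor ?_
        rw [Nat.cast_natAbs, Int.cast_abs]
        exact hzη i
  have hm0 := hMpos z hz
  have hprod := abs_mul_linForm_le (by positivity) hzL hzη (by
    have := mul_le_mul_of_nonneg_left hzX hX0.le
    rw [mul_inv_cancel₀ hX0.ne'] at this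
    linarith)
  have hlin : ((2 * X) ^ w⁻¹) ^ (-om) < |(z 0 : ℝ) + ∑ i : Fin n, θ i * (z i.succ : ℝ)| := by
    by_contra! hle
    exact hLX ⟨z, hz, hzη, hle⟩
  have hsim : X ^ (-lam) < (2 * |(z 0 : ℝ) + ∑ i : Fin n, θ i * (z i.succ : ℝ)|) ^ h := by
    by_contra! hle
    refine hSX ⟨x, ?_, le_rfl, fun i => (hzL i).trans hle⟩
    rintro h0
    rw [hX, h0] at hX0
    simp at hX0
  set m := |(z 0 : ℝ) + ∑ i : Fin n, θ i * (z i.succ : ℝ)|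
  have hn0 : 0 < (n : ℝ) := by
    obtain ⟨i, -⟩ := hz
    exact_mod_cast i.pos
  have l2 := Real.log_pos one_lt_two
  have lX : 0 ≤ Real.log X := Real.log_nonneg hX1
  have e1 := Real.log_le_log (by positivity) hzX
  have e2 := Real.log_lt_log (by positivity) hlin
  have e3 := Real.log_lt_log (by positivity) hsim
  have e4 := Real.log_le_log (by positivity) hprod
  rw [Real.log_inv, Real.log_mul two_ne_zero hm0.ne'] at e1
  rw [Real.log_rpow (by positivity), Real.log_rpow (by positivity),
    Real.log_mul two_ne_zero hX0.ne'] at e2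
  rw [Real.log_rpow (by positivity), Real.log_rpow (by positivity),
    Real.log_mul two_ne_zero hm0.ne'] at e3
  rw [Real.log_mul hX0.ne' hm0.ne', Real.log_mul hn0.ne' (by positivity),
    Real.log_mul (by positivity) (by positivity), Real.log_rpow (by positivity),
    Real.log_rpow (by positivity), Real.log_mul two_ne_zero hX0.ne',
    Real.log_mul two_ne_zero hm0.ne'] at e4
  have key := log_height_le (a := Real.log 2 + Real.log X) (m := -(Real.log 2 + Real.log m))
    (C := C) hlam.le hom hw (by linarith) hlt (by nlinarith)
    (by rw [div_eq_inv_mul]; linarith) (by simp only [C]; linarith)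
  rw [← hD] at key
  linarith

lemma SimSolvable.mono {n : ℕ} {θ : Fin n → ℝ} {γ γ' t : ℝ} (h : γ ≤ γ') (ht : 1 ≤ t)
    (hs : SimSolvable n θ γ' t) : SimSolvable n θ γ t := by
  obtain ⟨x, h0, h1, h2⟩ := hs
  exact ⟨x, h0, h1, fun i => (h2 i).trans (Real.rpow_le_rpow_of_exponent_le ht (neg_le_neg h))⟩

lemma LinSolvable.mono {n : ℕ} {θ : Fin n → ℝ} {γ γ' t : ℝ} (h : γ ≤ γ') (ht : 1 ≤ t)
    (hs : LinSolvable n θ γ' t) : LinSolvable n θ γ t := by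
  obtain ⟨x, h0, h1, h2⟩ := hs
  exact ⟨x, h0, h1, h2.trans (Real.rpow_le_rpow_of_exponent_le ht (neg_le_neg h))⟩

lemma eventually_not_simSolvable {n : ℕ} {θ : Fin n → ℝ} {γ : ℝ} (hγ : 0 < γ)
    (h : lambdaExp n θ < ENNReal.ofReal γ) : ∀ᶠ t in atTop, ¬ SimSolvable n θ γ t := by
  by_contra hc
  refine h.not_ge (le_sSup ⟨γ, hγ, rfl, fun T => ?_⟩)
  obtain ⟨t, ht, hs⟩ := (frequently_atTop'.1 hc) T
  exact ⟨t, ht, hs⟩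

lemma eventually_not_linSolvable {n : ℕ} {θ : Fin n → ℝ} {γ : ℝ} (hγ : 0 < γ)
    (h : omegaExp n θ < ENNReal.ofReal γ) : ∀ᶠ t in atTop, ¬ LinSolvable n θ γ t := by
  by_contra hc
  refine h.not_ge (le_sSup ⟨γ, hγ, rfl, fun T => ?_⟩)
  obtain ⟨t, ht, hs⟩ := (frequently_atTop'.1 hc) T
  exact ⟨t, ht, hs⟩

lemma eventually_simSolvable {n : ℕ} {θ : Fin n → ℝ} {γ : ℝ}
    (h : ENNReal.ofReal γ < lambdaHatExp n θ) : ∀ᶠ t in atTop, SimSolvable n θ γ t := by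
  obtain ⟨_, ⟨γ', hγ', rfl, T, hT⟩, hlt⟩ := lt_sSup_iff.1 h
  filter_upwards [eventually_gt_atTop T, eventually_ge_atTop 1] with t ht ht1
  exact (hT t ht).mono ((ENNReal.ofReal_lt_ofReal_iff hγ').1 hlt).le ht1

lemma eventually_linSolvable {n : ℕ} {θ : Fin n → ℝ} {γ : ℝ}
    (h : ENNReal.ofReal γ < omegaHatExp n θ) : ∀ᶠ t in atTop, LinSolvable n θ γ t := by
  obtain ⟨_, ⟨γ', hγ', rfl, T, hT⟩, hlt⟩ := lt_sSup_iff.1 h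
  filter_upwards [eventually_gt_atTop T, eventually_ge_atTop 1] with t ht ht1
  exact (hT t ht).mono ((ENNReal.ofReal_lt_ofReal_iff hγ').1 hlt).le ht1

lemma omegaHatExp_le_omegaExp (n : ℕ) (θ : Fin n → ℝ) : omegaHatExp n θ ≤ omegaExp n θ := by
  refine sSup_le_sSup ?_
  rintro _ ⟨γ, hγ, rfl, T, hT⟩
  exact ⟨γ, hγ, rfl, fun S => ⟨max S T + 1, by linarith [le_max_left S T],
    hT _ (by linarith [le_max_right S T])⟩⟩

/-- Trivial simultaneous approximations of quality `1` with prescribed height. -/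
lemma eventually_exists_approx_one (n : ℕ) (θ : Fin n → ℝ) (K : ℝ) :
    ∀ᶠ t : ℝ in atTop, ∃ x : Fin (n+1) → ℤ, K ≤ |(x 0 : ℝ)| ∧ |(x 0 : ℝ)| ≤ t ∧
      ∀ i : Fin n, |(x 0 : ℝ) * θ i - (x i.succ : ℝ)| ≤ t ^ (-0 : ℝ) := by
  filter_upwards [eventually_ge_atTop ((⌈|K|⌉₊ : ℕ) : ℝ)] with t ht
  refine ⟨Fin.cons (⌈|K|⌉₊ : ℤ) fun i => round ((⌈|K|⌉₊ : ℝ) * θ i), ?_, ?_, fun i => ?_⟩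
  · simpa using (le_abs_self K).trans (Nat.le_ceil _)
  · simpa using ht
  · simpa using (abs_sub_round ((⌈|K|⌉₊ : ℝ) * θ i)).trans (by norm_num)

/-- Uniform approximations have unbounded heights when the regular exponent is finite. -/
lemma eventually_exists_approx_of_uniform {n : ℕ} {θ : Fin n → ℝ} {h lam : ℝ} (hh : 0 < h)
    (hS : ∀ᶠ t in atTop, ¬ SimSolvable n θ lam t)
    (hS' : ∀ᶠ t in atTop, SimSolvable n θ h t) (K : ℝ) :
    ∀ᶠ t : ℝ in atTop, ∃ x : Fin (n+1) → ℤ, K ≤ |(x 0 : ℝ)| ∧ |(x 0 : ℝ)| ≤ t ∧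
      ∀ i : Fin n, |(x 0 : ℝ) * θ i - (x i.succ : ℝ)| ≤ t ^ (-h) := by
  obtain ⟨s, hs, hs0, hsK⟩ :=
    (hS.and ((eventually_gt_atTop (0 : ℝ)).and (eventually_ge_atTop K))).exists
  filter_upwards [hS', (tendsto_rpow_neg_atTop hh).eventually
    (ge_mem_nhds (Real.rpow_pos_of_pos hs0 (-lam)))] with t ⟨x, hx0, hxt, hxL⟩ ht
  refine ⟨x, ?_, hxt, hxL⟩
  by_contra! hK
  exact hs ⟨x, hx0, hK.le.trans hsK, fun i => (hxL i).trans ht⟩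

/-- if `1, θ₁, …, θₙ` are linearly independent over `ℚ`, `ω < ∞` and `λ̂ < 1`,
then `(1 + λ)/(1 + ω⁻¹) ≥ (1 - ω̂⁻¹)/(1 - λ̂)` (with `ω̂⁻¹ = 0` if `ω̂ = ∞`). -/
theorem stmt4 (n : ℕ) (hn : 2 ≤ n) (θ : Fin n → ℝ)
    (hindep : LinearIndependent ℚ (Fin.cons 1 θ : Fin (n+1) → ℝ))
    (hω : omegaExp n θ < ⊤) (hlamhat : lambdaHatExp n θ < 1) :
    (1 + lambdaExp n θ) / (1 + (omegaExp n θ)⁻¹) ≥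
      (1 - (omegaHatExp n θ)⁻¹) / (1 - lambdaHatExp n θ) := by
  rcases le_or_gt (omegaHatExp n θ) 1 with hoh | hoh
  · rw [tsub_eq_zero_of_le (ENNReal.one_le_inv.2 hoh), ENNReal.zero_div]
    exact zero_le
  have hle := omegaHatExp_le_omegaExp n θ
  have hF1 := fun γ => @eventually_not_simSolvable n θ γ
  have hF2 := fun γ => @eventually_not_linSolvable n θ γ
  have hF3 := fun γ => @eventually_simSolvable n θ γ
  have hF4 := fun γ => @eventually_linSolvable n θ γ
  have hoht : omegaHatExp n θ ≠ ⊤ := (hle.trans_lt hω).ne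
  generalize omegaHatExp n θ = oh at *
  generalize omegaExp n θ = o at *
  generalize lambdaHatExp n θ = lh at *
  rcases eq_or_ne (lambdaExp n θ) ⊤ with hlt | hlt
  · rw [hlt, add_top, ENNReal.top_div_of_ne_top]
    · exact le_top
    · simpa using (zero_lt_one.trans (hoh.trans_le hle)).ne'
  generalize lambdaExp n θ = l at *
  lift l to NNReal using hlt
  lift o to NNReal using hω.ne
  lift oh to NNReal using hoht
  lift lh to NNReal using (hlamhat.trans ENNReal.one_lt_top).ne
  norm_cast at hoh hle hlamhat
  have hoh0 : oh ≠ 0 := (zero_lt_one.trans hoh).ne'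
  have ho0 : o ≠ 0 := (zero_lt_one.trans (hoh.trans_le hle)).ne'
  have hsub : (1 - lh) ≠ 0 := (tsub_pos_of_lt hlamhat).ne'
  rw [← ENNReal.coe_inv hoh0, ← ENNReal.coe_inv ho0]
  norm_cast
  rw [← ENNReal.coe_div hsub, ← ENNReal.coe_div (by positivity), ge_iff_le, ENNReal.coe_le_coe,
    ← NNReal.coe_le_coe]
  push_cast [NNReal.coe_sub hlamhat.le, NNReal.coe_sub (inv_le_one_of_one_le₀ hoh.le)]
  have hoh' : (1 : ℝ) < oh := hoh
  have hlh' : (lh : ℝ) < 1 := hlamhat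
  have ho' : (0 : ℝ) < o := by positivity
  have hl' : (0 : ℝ) ≤ l := l.2
  suffices hreal : (1 - (oh : ℝ)⁻¹) / (1 + (l : ℝ)) ≤ (1 - (lh : ℝ)) / (1 + (o : ℝ)⁻¹) by
    rw [div_le_div_iff₀ (by positivity) (by positivity)] at hreal
    rw [div_le_div_iff₀ (by linarith) (by positivity)]
    linarith
  have hδ : ∀ᶠ δ : ℝ in 𝓝[>] 0, (1 - (oh - δ : ℝ)⁻¹) / (1 + (l + δ : ℝ)) ≤
      (1 - max (lh - δ : ℝ) 0) / (1 + (o + δ : ℝ)⁻¹) := by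
    have hsmall : ∀ᶠ δ : ℝ in 𝓝[>] 0, δ < oh - 1 :=
      nhdsWithin_le_nhds (gt_mem_nhds (by linarith))
    filter_upwards [hsmall, self_mem_nhdsWithin] with δ hδ1 hδ0
    have hδ0 : 0 < δ := hδ0
    have hS := hF1 (l + δ) (by positivity) (by
      rw [← ENNReal.ofReal_coe_nnreal, ENNReal.ofReal_lt_ofReal_iff (by positivity)]; linarith)
    have hL := hF2 (o + δ) (by positivity) (by
      rw [← ENNReal.ofReal_coe_nnreal, ENNReal.ofReal_lt_ofReal_iff (by positivity)]; linarith)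
    have hL' := hF4 (oh - δ) (by
      rw [← ENNReal.ofReal_coe_nnreal, ENNReal.ofReal_lt_ofReal_iff (by linarith)]; linarith)
    refine exponent_transference (by positivity) (by positivity) (le_max_right _ _)
      (by linarith) hS hL ?_ hL'
    rcases le_or_gt (lh - δ : ℝ) 0 with h0 | h0
    · rw [max_eq_right h0]
      exact eventually_exists_approx_one n θ
    · rw [max_eq_left h0.le]
      refine eventually_exists_approx_of_uniform h0 hS (hF3 _ ?_)
      rw [← ENNReal.ofReal_coe_nnreal, ENNReal.ofReal_lt_ofReal_iff (by linarith)]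
      linarith
  have hc1 : ContinuousAt (fun δ : ℝ => (1 - (oh - δ : ℝ)⁻¹) / (1 + (l + δ : ℝ))) 0 := by
    refine ContinuousAt.div (continuousAt_const.sub (ContinuousAt.inv₀ (by fun_prop) ?_))
      (by fun_prop) ?_ <;> simp <;> positivity
  have hc2 : ContinuousAt
      (fun δ : ℝ => (1 - max (lh - δ : ℝ) 0) / (1 + (o + δ : ℝ)⁻¹)) 0 := by
    refine ContinuousAt.div (by fun_prop)
      (continuousAt_const.add (ContinuousAt.inv₀ (by fun_prop) ?_)) ?_ <;> simp <;> positivity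
  have hlim := le_of_tendsto_of_tendsto (hc1.tendsto.mono_left nhdsWithin_le_nhds)
    (hc2.tendsto.mono_left nhdsWithin_le_nhds) hδ
  simpa using hlim
end

section
/- Suppose 1, θ₁, …, θₙ are linearly independent over ℚ, ω < ∞, and λ̂ < 1. Then λ/λ̂ ≥ (1 − ω̂^{−1})/(1 − λ̂). -/
open scoped ENNReal


/-- The integer points `x` with `x₀ ≠ 0` whose approximation error is at most `ε`. -/
def ApproxWithin {n : ℕ} (θ : Fin n → ℝ) (ε : ℝ) (x : Fin (n + 1) → ℤ) : Prop :=
  x 0 ≠ 0 ∧ ∀ i : Fin n, |(x 0 : ℝ) * θ i - (x i.succ : ℝ)| ≤ ε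

lemma ApproxWithin.mono {n : ℕ} {θ : Fin n → ℝ} {ε ε' : ℝ} {x : Fin (n + 1) → ℤ}
    (h : ApproxWithin θ ε x) (hε : ε ≤ ε') : ApproxWithin θ ε' x :=
  ⟨h.1, fun i => (h.2 i).trans hε⟩

lemma one_le_abs_cast_of_ne_zero {z : ℤ} (hz : z ≠ 0) : (1 : ℝ) ≤ |(z : ℝ)| := by
  exact_mod_cast Int.one_le_abs hz

/-- The integer scalar product of `y` and `x` is close to `x₀ L(y)`. -/
lemma abs_dot_sub_mul_linForm_le {n : ℕ} {θ : Fin n → ℝ} {ε t : ℝ}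
    {x y : Fin (n + 1) → ℤ} (hx : ApproxWithin θ ε x) (ht : 0 ≤ t)
    (hy : ∀ i : Fin n, (|y i.succ| : ℝ) ≤ t) :
    |((∑ j, y j * x j : ℤ) : ℝ) -
      (x 0 : ℝ) * ((y 0 : ℝ) + ∑ i : Fin n, θ i * (y i.succ : ℝ))| ≤ n * t * ε := by
  have h : ((∑ j, y j * x j : ℤ) : ℝ) -
      (x 0 : ℝ) * ((y 0 : ℝ) + ∑ i : Fin n, θ i * (y i.succ : ℝ)) =
      -∑ i : Fin n, (y i.succ : ℝ) * ((x 0 : ℝ) * θ i - (x i.succ : ℝ)) := by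
    rw [Fin.sum_univ_succ]
    push_cast
    simp only [mul_sub, Finset.sum_sub_distrib, mul_add, Finset.mul_sum]
    have : ∀ i : Fin n, (y i.succ : ℝ) * ((x 0 : ℝ) * θ i) = x 0 * (θ i * y i.succ) :=
      fun i => by ring
    simp only [this]
    ring
  rw [h, abs_neg]
  refine (Finset.abs_sum_le_sum_abs _ _).trans ?_
  have h1 : ∀ i ∈ (Finset.univ : Finset (Fin n)),
      |(y i.succ : ℝ) * ((x 0 : ℝ) * θ i - (x i.succ : ℝ))| ≤ t * ε := fun i _ => by
    rw [abs_mul]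
    exact mul_le_mul (hy i) (hx.2 i) (abs_nonneg _) ht
  refine (Finset.sum_le_sum h1).trans (le_of_eq ?_)
  simp [mul_assoc]

lemma linForm_ne_zero {n : ℕ} {θ : Fin n → ℝ}
    (hindep : LinearIndependent ℚ (Fin.cons 1 θ : Fin (n + 1) → ℝ))
    {y : Fin (n + 1) → ℤ} (hy : y ≠ 0) :
    (y 0 : ℝ) + ∑ i : Fin n, θ i * (y i.succ : ℝ) ≠ 0 := by
  intro h
  rw [Fintype.linearIndependent_iff] at hindep
  have := hindep (fun i => (y i : ℚ)) (by
    rw [Fin.sum_univ_succ]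
    simp only [Fin.cons_zero, Fin.cons_succ, Rat.smul_def]
    push_cast
    rw [← h]
    simp [mul_comm])
  exact hy (funext fun i => by exact_mod_cast this i)

/-- Good approximations have large denominators. -/
lemma exists_forall_approxWithin_lt {n : ℕ} {θ : Fin n → ℝ} (hn : 0 < n)
    (hindep : LinearIndependent ℚ (Fin.cons 1 θ : Fin (n + 1) → ℝ)) (M : ℕ) :
    ∃ ε > 0, ∀ x : Fin (n + 1) → ℤ, ApproxWithin θ ε x → M < (x 0).natAbs := by
  have hirr : ∀ q p : ℤ, q ≠ 0 → (q : ℝ) * θ ⟨0, hn⟩ - p ≠ 0 := by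
    intro q p hq h
    have hy : (Fin.cons (-p) (Pi.single ⟨0, hn⟩ q) : Fin (n + 1) → ℤ) ≠ 0 := fun h0 => by
      have := congrFun h0 (Fin.succ ⟨0, hn⟩)
      simp at this
      exact hq this
    refine linForm_ne_zero hindep hy ?_
    rw [Finset.sum_eq_single ⟨0, hn⟩]
    · simp only [Fin.cons_zero, Fin.cons_succ, Pi.single_eq_same]
      push_cast
      linarith
    · intro i _ hi
      simp [Pi.single_eq_of_ne hi]
    · simp
  induction M with
  | zero => exact ⟨1, one_pos, fun x hx => Int.natAbs_pos.2 hx.1⟩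
  | succ M ih =>
    obtain ⟨ε, hε, h⟩ := ih
    have hd : ∀ q : ℤ, q ≠ 0 → 0 < |(q : ℝ) * θ ⟨0, hn⟩ - round ((q : ℝ) * θ ⟨0, hn⟩)| :=
      fun q hq => abs_pos.2 (hirr _ _ hq)
    have h1 := hd (M + 1 : ℤ) (by omega)
    have h2 := hd (-(M + 1 : ℤ)) (by omega)
    refine ⟨min ε (min _ _ / 2), lt_min hε (half_pos (lt_min h1 h2)), fun x hx => ?_⟩
    have hM := h x (hx.mono (min_le_left _ _))
    by_contra hlt
    have hx0 : x 0 = M + 1 ∨ x 0 = -(M + 1 : ℤ) := by omega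
    have hm := (hx.2 ⟨0, hn⟩).trans (min_le_right _ _)
    have hr := (round_le ((x 0 : ℝ) * θ ⟨0, hn⟩) (x (Fin.succ ⟨0, hn⟩))).trans hm
    have hpos := lt_min h1 h2
    rcases hx0 with h0 | h0 <;> rw [h0] at hr
    · linarith [min_le_left
        |((M + 1 : ℤ) : ℝ) * θ ⟨0, hn⟩ - round (((M + 1 : ℤ) : ℝ) * θ ⟨0, hn⟩)|
        |((-(M + 1) : ℤ) : ℝ) * θ ⟨0, hn⟩ - round (((-(M + 1) : ℤ) : ℝ) * θ ⟨0, hn⟩)|]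
    · linarith [min_le_right
        |((M + 1 : ℤ) : ℝ) * θ ⟨0, hn⟩ - round (((M + 1 : ℤ) : ℝ) * θ ⟨0, hn⟩)|
        |((-(M + 1) : ℤ) : ℝ) * θ ⟨0, hn⟩ - round (((-(M + 1) : ℤ) : ℝ) * θ ⟨0, hn⟩)|]

/-- A nonempty set of integer points has an element with `|x₀|` minimal. -/
lemma exists_min_natAbs {n : ℕ} {P : (Fin (n + 1) → ℤ) → Prop} (h : ∃ x, P x) :
    ∃ x, P x ∧ ∀ z, P z → (x 0).natAbs ≤ (z 0).natAbs := by
  obtain ⟨x, hx, hmin⟩ := (measure fun x : Fin (n + 1) → ℤ => (x 0).natAbs).wf.has_min {x | P x} h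
  exact ⟨x, hx, fun z hz => not_lt.1 (hmin z hz)⟩

lemma exists_approxWithin_of_forall_simSolvable {n : ℕ} {θ : Fin n → ℝ} {α T : ℝ} (hα : 0 < α)
    (hsim : ∀ t : ℝ, T < t → SimSolvable n θ α t) {ε : ℝ} (hε : 0 < ε) :
    ∃ x, ApproxWithin θ ε x := by
  obtain ⟨t, h1, h2⟩ := (((tendsto_rpow_neg_atTop hα).eventually (ge_mem_nhds hε)).and
    (Filter.eventually_gt_atTop T)).exists
  obtain ⟨x, hx0, -, hx⟩ := hsim t h2
  exact ⟨x, hx0, fun i => (hx i).trans h1⟩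

/-- The good approximations do not all lie in one rational hyperplane. -/
lemma exists_approxWithin_dot_ne_zero {n : ℕ} {θ : Fin n → ℝ} {α T : ℝ} (hα : 0 < α)
    (hindep : LinearIndependent ℚ (Fin.cons 1 θ : Fin (n + 1) → ℝ))
    (hsim : ∀ t : ℝ, T < t → SimSolvable n θ α t) {ε : ℝ} (hε : 0 < ε)
    {y : Fin (n + 1) → ℤ} (hy0 : y ≠ 0) {t : ℝ} (ht : 0 ≤ t)
    (hy : ∀ i : Fin n, (|y i.succ| : ℝ) ≤ t) :
    ∃ x, ApproxWithin θ ε x ∧ ∑ j, y j * x j ≠ 0 := by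
  by_contra! hcon
  have hL := abs_pos.2 (linForm_ne_zero hindep hy0)
  set L := (y 0 : ℝ) + ∑ i : Fin n, θ i * (y i.succ : ℝ) with hLdef
  have hnt : 0 < n * t + 1 := by positivity
  obtain ⟨x, hx⟩ := exists_approxWithin_of_forall_simSolvable hα hsim
    (lt_min hε (div_pos (half_pos hL) hnt))
  have h1 := abs_dot_sub_mul_linForm_le hx ht hy
  rw [hcon x (hx.mono (min_le_left _ _)), Int.cast_zero, zero_sub, abs_neg, abs_mul] at h1
  have h2 : |L| ≤ |(x 0 : ℝ)| * |L| :=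
    le_mul_of_one_le_left hL.le (one_le_abs_cast_of_ne_zero hx.1)
  have h3 : n * t * min ε (|L| / 2 / (n * t + 1)) ≤ (n * t + 1) * (|L| / 2 / (n * t + 1)) := by
    apply mul_le_mul (by linarith) (min_le_right _ _) (le_min hε.le (by positivity)) hnt.le
  rw [mul_div_cancel₀ _ hnt.ne'] at h3
  linarith

/-- There are good approximations `x` with arbitrarily large `|x₀|` for which the next relevant
denominator `Q` is large in terms of `|x₀|`. -/
lemma exists_gap {n : ℕ} {θ : Fin n → ℝ} (hn : 0 < n)
    (hindep : LinearIndependent ℚ (Fin.cons 1 θ : Fin (n + 1) → ℝ))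
    {α γ : ℝ} (hα : 0 < α) (hγ : 0 < γ) (hαγ : γ⁻¹ < α) {T₁ T₂ : ℝ}
    (hsim : ∀ t : ℝ, T₁ < t → SimSolvable n θ α t)
    (hlin : ∀ t : ℝ, T₂ < t → LinSolvable n θ γ t) (M : ℝ) :
    ∃ (x : Fin (n + 1) → ℤ) (Q : ℝ), M < |(x 0 : ℝ)| ∧ |(x 0 : ℝ)| ≤ Q / 2 ∧
      ApproxWithin θ ((Q / 2) ^ (-α)) x ∧
      |(x 0 : ℝ)| ≤ 2 * n * (4 * |(x 0 : ℝ)|) ^ γ⁻¹ * Q * (Q / 2) ^ (-α) := by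
  have hn' : (0 : ℝ) < n := Nat.cast_pos.2 hn
  have hev : ∀ᶠ q : ℝ in Filter.atTop, M < q ∧ T₁ < q ∧ T₂ < (4 * q) ^ γ⁻¹ ∧ 1 ≤ q ∧
      q ^ (-α) ≤ 1 / (2 * n * (4 * q) ^ γ⁻¹) := by
    have e1 : Filter.Tendsto (fun q : ℝ => (4 * q) ^ γ⁻¹) Filter.atTop Filter.atTop :=
      (tendsto_rpow_atTop (inv_pos.2 hγ)).comp (Filter.tendsto_id.const_mul_atTop (by norm_num))
    have e2 := (tendsto_rpow_atTop (sub_pos.2 hαγ)).eventually_ge_atTop (2 * n * 4 ^ γ⁻¹)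
    filter_upwards [Filter.eventually_gt_atTop M, Filter.eventually_gt_atTop T₁,
      e1.eventually_gt_atTop T₂, Filter.eventually_ge_atTop 1, e2] with q h1 h2 h3 h4 h5
    refine ⟨h1, h2, h3, h4, ?_⟩
    have hq : 0 < q := by linarith
    rw [Real.rpow_neg hq.le, ← one_div]
    apply one_div_le_one_div_of_le (by positivity)
    rw [Real.mul_rpow (by norm_num) hq.le, ← mul_assoc]
    calc 2 * n * 4 ^ γ⁻¹ * q ^ γ⁻¹ ≤ q ^ (α - γ⁻¹) * q ^ γ⁻¹ := by gcongr
      _ = q ^ α := by rw [← Real.rpow_add hq]; congr 1; ring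
  obtain ⟨M', hM'⟩ := Filter.eventually_atTop.1 hev
  obtain ⟨N, hN⟩ := exists_nat_ge M'
  obtain ⟨ε, hε, hεN⟩ := exists_forall_approxWithin_lt hn hindep N
  obtain ⟨z, hz, hzmin⟩ := exists_min_natAbs
    (exists_approxWithin_of_forall_simSolvable hα hsim hε)
  set q : ℝ := |(z 0 : ℝ)| with hq
  have hqN : q = ((z 0).natAbs : ℝ) := by rw [hq, Nat.cast_natAbs, Int.cast_abs]
  obtain ⟨hMq, hTq, hTt, hq1, hqη⟩ := hM' q (hN.trans (by
    rw [hqN]; exact_mod_cast (hεN z hz).le))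
  set t : ℝ := (4 * q) ^ γ⁻¹ with ht
  have htpos : 0 < t := by positivity
  obtain ⟨y, ⟨i, hyi⟩, hyt, hyL⟩ := hlin t hTt
  have htγ : t ^ (-γ) = 1 / (4 * q) := by
    rw [ht, ← Real.rpow_mul (by positivity), mul_neg, inv_mul_cancel₀ hγ.ne',
      Real.rpow_neg_one, one_div]
  rw [htγ] at hyL
  have hy0 : y ≠ 0 := fun h => hyi (by rw [h]; rfl)
  set L := (y 0 : ℝ) + ∑ i : Fin n, θ i * (y i.succ : ℝ) with hL
  obtain ⟨w, ⟨hw, hwne⟩, hwmin⟩ := exists_min_natAbs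
    (exists_approxWithin_dot_ne_zero hα hindep hsim
      (show (0 : ℝ) < 1 / (2 * n * t) by positivity) hy0 htpos.le hyt)
  set Q : ℝ := |(w 0 : ℝ)| with hQ
  have hQpos : 0 < Q := one_pos.trans_le (one_le_abs_cast_of_ne_zero hw.1)
  have hQL : 1 / 2 ≤ Q * |L| := by
    have h1 := abs_dot_sub_mul_linForm_le hw htpos.le hyt
    have h2 := one_le_abs_cast_of_ne_zero hwne
    have h3 : n * t * (1 / (2 * n * t)) = 1 / 2 := by field_simp
    rw [h3, ← hL] at h1
    rw [hQ, ← abs_mul]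
    have h4 := abs_sub_abs_le_abs_sub ((∑ j, y j * w j : ℤ) : ℝ) ((w 0 : ℝ) * L)
    linarith
  have hQq : q ≤ Q / 2 := by
    have h1 : 1 / 2 ≤ Q * (1 / (4 * q)) := hQL.trans (by gcongr)
    have h2 : Q * (1 / (4 * q)) = Q / 2 / (2 * q) := by field_simp; norm_num
    rw [h2, le_div_iff₀ (by positivity)] at h1
    linarith
  obtain ⟨x, hxq, hxQ, hx⟩ : ∃ x : Fin (n + 1) → ℤ, q ≤ |(x 0 : ℝ)| ∧ |(x 0 : ℝ)| ≤ Q / 2 ∧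
      ApproxWithin θ ((Q / 2) ^ (-α)) x := by
    by_cases hle : ε ≤ (Q / 2) ^ (-α)
    · exact ⟨z, le_rfl, hQq, hz.mono hle⟩
    · obtain ⟨x, hx0, hxQ, hx⟩ := hsim (Q / 2) (by linarith)
      have hx' : ApproxWithin θ ((Q / 2) ^ (-α)) x := ⟨hx0, hx⟩
      refine ⟨x, ?_, hxQ, hx'⟩
      have := hzmin x (hx'.mono (not_le.1 hle).le)
      rw [hq, ← Int.cast_abs, ← Int.cast_abs, Int.abs_eq_natAbs, Int.abs_eq_natAbs]
      exact_mod_cast this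
  refine ⟨x, Q, hMq.trans_le hxq, hxQ, hx, ?_⟩
  have hη : (Q / 2) ^ (-α) ≤ 1 / (2 * n * t) :=
    (Real.rpow_le_rpow_of_nonpos (by linarith) hQq (by linarith)).trans hqη
  have hdot : ∑ j, y j * x j = 0 := by
    by_contra hne
    have h1 := hwmin x ⟨hx.mono hη, hne⟩
    have h2 : Q ≤ |(x 0 : ℝ)| := by
      rw [hQ, ← Int.cast_abs, ← Int.cast_abs, Int.abs_eq_natAbs, Int.abs_eq_natAbs]
      exact_mod_cast h1
    linarith
  have h1 := abs_dot_sub_mul_linForm_le hx htpos.le hyt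
  rw [hdot, ← hL, Int.cast_zero, zero_sub, abs_neg, abs_mul] at h1
  have htx : t ≤ (4 * |(x 0 : ℝ)|) ^ γ⁻¹ := by rw [ht]; gcongr
  calc |(x 0 : ℝ)| ≤ 2 * Q * (|(x 0 : ℝ)| * |L|) := by
        nlinarith [abs_nonneg (x 0 : ℝ)]
    _ ≤ 2 * Q * (n * t * (Q / 2) ^ (-α)) := by gcongr
    _ = 2 * n * t * Q * (Q / 2) ^ (-α) := by ring
    _ ≤ _ := by gcongr

/-- Transference between uniform exponents and the regular simultaneous exponent, for real
parameters. -/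
lemma exists_simSolvable_of_forall_solvable {n : ℕ} {θ : Fin n → ℝ} (hn : 0 < n)
    (hindep : LinearIndependent ℚ (Fin.cons 1 θ : Fin (n + 1) → ℝ))
    {α γ β : ℝ} (hα : 0 < α) (hα1 : α < 1) (hγ : 0 < γ) (hαγ : γ⁻¹ < α)
    (hβ : β * (1 - α) < α * (1 - γ⁻¹)) {T₁ T₂ : ℝ}
    (hsim : ∀ t : ℝ, T₁ < t → SimSolvable n θ α t)
    (hlin : ∀ t : ℝ, T₂ < t → LinSolvable n θ γ t) (M : ℝ) :
    ∃ t : ℝ, M < t ∧ SimSolvable n θ β t := by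
  have hn' : (0 : ℝ) < n := Nat.cast_pos.2 hn
  obtain ⟨M', hM'⟩ := Filter.eventually_atTop.1
    ((Real.tendsto_log_atTop.const_mul_atTop (sub_pos.2 hβ)).eventually_ge_atTop
      (α * (Real.log (2 * n) + γ⁻¹ * Real.log 4 + Real.log 2)))
  obtain ⟨x, Q, hxM, hxQ, hx, hgap⟩ :=
    exists_gap hn hindep hα hγ hαγ hsim hlin (max M M')
  have hqpos : 0 < |(x 0 : ℝ)| := one_pos.trans_le (one_le_abs_cast_of_ne_zero hx.1)
  have hlog := hM' |(x 0 : ℝ)| ((le_max_right _ _).trans hxM.le)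
  refine ⟨|(x 0 : ℝ)|, (le_max_left _ _).trans_lt hxM, x, hx.1, le_rfl,
    fun i => (hx.2 i).trans ?_⟩
  set q : ℝ := |(x 0 : ℝ)|
  have hQ2 : 0 < Q / 2 := hqpos.trans_le hxQ
  have hQ : 0 < Q := by linarith
  have h1 := Real.log_le_log hqpos hgap
  rw [Real.log_mul (by positivity) (by positivity), Real.log_mul (by positivity) (by positivity),
    Real.log_mul (by positivity) (by positivity), Real.log_rpow (by positivity),
    Real.log_rpow hQ2, Real.log_mul (by norm_num) hqpos.ne'] at h1
  have hQlog : Real.log Q = Real.log (Q / 2) + Real.log 2 := by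
    rw [Real.log_div hQ.ne' (by norm_num)]; ring
  rw [hQlog] at h1
  rw [← Real.log_le_log_iff (by positivity) (by positivity), Real.log_rpow hQ2,
    Real.log_rpow hqpos]
  have h2 := mul_le_mul_of_nonneg_left h1 hα.le
  have h3 : β * Real.log q * (1 - α) ≤ α * Real.log (Q / 2) * (1 - α) := by linarith
  linarith [le_of_mul_le_mul_right h3 (sub_pos.2 hα1)]

lemma SimSolvable.anti {n : ℕ} {θ : Fin n → ℝ} {α β t : ℝ} (h : SimSolvable n θ β t)
    (hαβ : α ≤ β) (ht : 1 ≤ t) : SimSolvable n θ α t := by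
  obtain ⟨x, h0, h1, h2⟩ := h
  exact ⟨x, h0, h1, fun i =>
    (h2 i).trans (Real.rpow_le_rpow_of_exponent_le ht (neg_le_neg hαβ))⟩

lemma LinSolvable.anti {n : ℕ} {θ : Fin n → ℝ} {α β t : ℝ} (h : LinSolvable n θ β t)
    (hαβ : α ≤ β) (ht : 1 ≤ t) : LinSolvable n θ α t := by
  obtain ⟨x, h0, h1, h2⟩ := h
  exact ⟨x, h0, h1, h2.trans (Real.rpow_le_rpow_of_exponent_le ht (neg_le_neg hαβ))⟩

lemma forall_simSolvable_of_lt_lambdaHatExp {n : ℕ} {θ : Fin n → ℝ} {α : ℝ}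
    (h : ENNReal.ofReal α < lambdaHatExp n θ) :
    ∃ T : ℝ, ∀ t : ℝ, T < t → SimSolvable n θ α t := by
  obtain ⟨_, ⟨β, hβ, rfl, T, hT⟩, hlt⟩ := lt_sSup_iff.1 h
  refine ⟨max T 1, fun t ht => (hT t ((le_max_left _ _).trans_lt ht)).anti ?_
    ((le_max_right _ _).trans ht.le)⟩
  exact ((ENNReal.ofReal_lt_ofReal_iff hβ).1 hlt).le

lemma forall_linSolvable_of_lt_omegaHatExp {n : ℕ} {θ : Fin n → ℝ} {γ : ℝ}
    (h : ENNReal.ofReal γ < omegaHatExp n θ) :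
    ∃ T : ℝ, ∀ t : ℝ, T < t → LinSolvable n θ γ t := by
  obtain ⟨_, ⟨β, hβ, rfl, T, hT⟩, hlt⟩ := lt_sSup_iff.1 h
  refine ⟨max T 1, fun t ht => (hT t ((le_max_left _ _).trans_lt ht)).anti ?_
    ((le_max_right _ _).trans ht.le)⟩
  exact ((ENNReal.ofReal_lt_ofReal_iff hβ).1 hlt).le

lemma lambdaHatExp_le_lambdaExp (n : ℕ) (θ : Fin n → ℝ) :
    lambdaHatExp n θ ≤ lambdaExp n θ := by
  refine sSup_le_sSup ?_
  rintro _ ⟨γ, hγ, rfl, T, hT⟩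
  exact ⟨γ, hγ, rfl, fun T' => ⟨max T T' + 1, by linarith [le_max_right T T'],
    hT _ (by linarith [le_max_left T T'])⟩⟩

/-- Dirichlet's theorem on simultaneous approximation. -/
lemma exists_approxWithin_inv {n : ℕ} (θ : Fin n → ℝ) {m : ℕ} (hm : 0 < m) :
    ∃ x : Fin (n + 1) → ℤ, ApproxWithin θ (1 / m) x ∧ |x 0| ≤ (m : ℤ) ^ n := by
  have hm' : (0 : ℝ) < m := Nat.cast_pos.2 hm
  have hlt : ∀ r : ℝ, ⌊Int.fract r * m⌋₊ < m := fun r => by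
    rw [Nat.floor_lt (mul_nonneg (Int.fract_nonneg r) hm'.le)]
    exact mul_lt_of_lt_one_left hm' (Int.fract_lt_one r)
  obtain ⟨a, b, hab, hf⟩ := Fintype.exists_ne_map_eq_of_card_lt
    (fun (k : Fin (m ^ n + 1)) (i : Fin n) => (⟨_, hlt ((k : ℝ) * θ i)⟩ : Fin m)) (by simp)
  refine ⟨Fin.cons ((a : ℤ) - b) fun i => ⌊(a : ℝ) * θ i⌋ - ⌊(b : ℝ) * θ i⌋, ⟨?_, ?_⟩, ?_⟩
  · simp only [Fin.cons_zero]
    have := Fin.val_ne_of_ne hab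
    omega
  · intro i
    have hi : ⌊Int.fract ((a : ℝ) * θ i) * m⌋₊ = ⌊Int.fract ((b : ℝ) * θ i) * m⌋₊ :=
      congrArg Fin.val (congrFun hf i)
    simp only [Fin.cons_zero, Fin.cons_succ]
    push_cast
    have ha1 := Nat.floor_le (mul_nonneg (Int.fract_nonneg ((a : ℝ) * θ i)) hm'.le)
    have ha2 := Nat.lt_floor_add_one (Int.fract ((a : ℝ) * θ i) * m)
    have hb1 := Nat.floor_le (mul_nonneg (Int.fract_nonneg ((b : ℝ) * θ i)) hm'.le)
    have hb2 := Nat.lt_floor_add_one (Int.fract ((b : ℝ) * θ i) * m)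
    rw [hi] at ha1 ha2
    have heq : ((a : ℝ) - b) * θ i - (⌊(a : ℝ) * θ i⌋ - ⌊(b : ℝ) * θ i⌋) =
        Int.fract ((a : ℝ) * θ i) - Int.fract ((b : ℝ) * θ i) := by
      rw [Int.fract, Int.fract]; ring
    have habs : ∀ r : ℝ, |r| * m = |r * m| := fun r => by rw [abs_mul, abs_of_pos hm']
    rw [heq, le_div_iff₀ hm', habs, sub_mul, abs_le]
    constructor <;> linarith
  · simp only [Fin.cons_zero]
    have ha := a.2
    have hb := b.2
    rw [abs_le]
    zify at ha hb
    constructor <;> linarith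

lemma lambdaHatExp_pos {n : ℕ} (hn : 0 < n) (θ : Fin n → ℝ) : 0 < lambdaHatExp n θ := by
  have hn' : (0 : ℝ) < n := Nat.cast_pos.2 hn
  have hγ : (0 : ℝ) < (2 * n : ℝ)⁻¹ := by positivity
  refine (ENNReal.ofReal_pos.2 hγ).trans_le (le_sSup ⟨_, hγ, rfl, ?_⟩)
  obtain ⟨T, hT⟩ := Filter.eventually_atTop.1
    ((tendsto_rpow_atTop hγ).eventually_ge_atTop 2)
  refine ⟨max T 0, fun t ht => ?_⟩
  have ht0 : 0 < t := (le_max_right _ _).trans_lt ht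
  have hs := hT t ((le_max_left _ _).trans ht.le)
  set s : ℝ := t ^ (2 * n : ℝ)⁻¹ with hsdef
  have hst : (s ^ 2) ^ n = t := by
    rw [← pow_mul, hsdef, ← Real.rpow_natCast, ← Real.rpow_mul ht0.le]
    push_cast
    rw [inv_mul_cancel₀ (by positivity), Real.rpow_one]
  have hms : (⌊s ^ 2⌋₊ : ℝ) ≤ s ^ 2 := Nat.floor_le (by positivity)
  have hsm : s ≤ (⌊s ^ 2⌋₊ : ℝ) := by nlinarith [Nat.lt_floor_add_one (s ^ 2)]
  have hm : 0 < ⌊s ^ 2⌋₊ := by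
    have : (0 : ℝ) < ⌊s ^ 2⌋₊ := by linarith
    exact_mod_cast this
  obtain ⟨x, hx, hxm⟩ := exists_approxWithin_inv θ hm
  refine ⟨x, hx.1, ?_, fun i => (hx.2 i).trans ?_⟩
  · calc |(x 0 : ℝ)| ≤ (⌊s ^ 2⌋₊ : ℝ) ^ n := by exact_mod_cast hxm
      _ ≤ (s ^ 2) ^ n := by gcongr
      _ = t := hst
  · rw [Real.rpow_neg ht0.le, ← one_div]
    exact one_div_le_one_div_of_le (by linarith) hsm

/-- Room for perturbing both parameters in a strict inequality. -/
lemma exists_perturbation {H V l : ℝ} (hVH : V < H)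
    (hl : l * (1 - H) < H * (1 - V)) :
    ∃ α s β : ℝ, V < s ∧ s < α ∧ α < H ∧ l < β ∧ β * (1 - α) < α * (1 - s) := by
  have hc : Filter.Tendsto (fun e : ℝ => (H - e) * (1 - (V + e)) - (l + e) * (1 - (H - e)))
      (nhdsWithin 0 (Set.Ioi 0)) (nhds (H * (1 - V) - l * (1 - H))) := by
    have : Continuous fun e : ℝ => (H - e) * (1 - (V + e)) - (l + e) * (1 - (H - e)) := by
      fun_prop
    have h := this.tendsto 0
    simp only [sub_zero, add_zero] at h
    exact h.mono_left nhdsWithin_le_nhds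
  obtain ⟨e, h1, h2, h3⟩ := ((hc.eventually (lt_mem_nhds (sub_pos.2 hl))).and
    ((Ioo_mem_nhdsGT (half_pos (sub_pos.2 hVH))))).exists
  exact ⟨H - e, V + e, l + e, by linarith, by linarith, by linarith, by linarith, by linarith⟩

/-- if `1, θ₁, …, θₙ` are linearly independent over `ℚ`, `ω < ∞` and `λ̂ < 1`,
then `λ/λ̂ ≥ (1 - ω̂⁻¹)/(1 - λ̂)` (with `ω̂⁻¹ = 0` if `ω̂ = ∞`). -/
theorem stmt6 (n : ℕ) (hn : 2 ≤ n) (θ : Fin n → ℝ)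
    (hindep : LinearIndependent ℚ (Fin.cons 1 θ : Fin (n+1) → ℝ))
    (hω : omegaExp n θ < ⊤) (hlamhat : lambdaHatExp n θ < 1) :
    lambdaExp n θ / lambdaHatExp n θ ≥
      (1 - (omegaHatExp n θ)⁻¹) / (1 - lambdaHatExp n θ) := by
  have hn0 : 0 < n := by omega
  have hpos := lambdaHatExp_pos hn0 θ
  have hle := lambdaHatExp_le_lambdaExp n θ
  have hhtop : lambdaHatExp n θ ≠ ⊤ := hlamhat.ne_top
  rw [ge_iff_le]
  by_cases hcase : lambdaHatExp n θ ≤ (omegaHatExp n θ)⁻¹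
  · calc _ ≤ (1 - lambdaHatExp n θ) / (1 - lambdaHatExp n θ) := by gcongr
      _ ≤ 1 := ENNReal.div_self_le_one
      _ ≤ _ := by rwa [ENNReal.le_div_iff_mul_le (Or.inl hpos.ne') (Or.inl hhtop), one_mul]
  rw [not_le] at hcase
  by_cases htop : lambdaExp n θ = ⊤
  · rw [htop, ENNReal.top_div_of_ne_top hhtop]
    exact le_top
  have hvtop : (omegaHatExp n θ)⁻¹ ≠ ⊤ := hcase.ne_top
  set H := (lambdaHatExp n θ).toReal with hH
  set V := ((omegaHatExp n θ)⁻¹).toReal with hV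
  set l := (lambdaExp n θ).toReal with hl
  have eH : lambdaHatExp n θ = ENNReal.ofReal H := (ENNReal.ofReal_toReal hhtop).symm
  have eV : (omegaHatExp n θ)⁻¹ = ENNReal.ofReal V := (ENNReal.ofReal_toReal hvtop).symm
  have el : lambdaExp n θ = ENNReal.ofReal l := (ENNReal.ofReal_toReal htop).symm
  have hV0 : 0 ≤ V := ENNReal.toReal_nonneg
  have hl0 : 0 ≤ l := ENNReal.toReal_nonneg
  have hVH : V < H := (ENNReal.toReal_lt_toReal hvtop hhtop).2 hcase
  have hH1 : H < 1 := by
    rw [hH, ← ENNReal.toReal_one]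
    exact (ENNReal.toReal_lt_toReal hhtop ENNReal.one_ne_top).2 hlamhat
  have hH0 : 0 < H := hV0.trans_lt hVH
  have key : H * (1 - V) ≤ l * (1 - H) := by
    by_contra! hlt
    obtain ⟨α, s, β, hVs, hsα, hαH, hlβ, hβ⟩ := exists_perturbation hVH hlt
    have hs0 : 0 < s := hV0.trans_lt hVs
    obtain ⟨T₁, hsim⟩ := forall_simSolvable_of_lt_lambdaHatExp (n := n) (θ := θ) (α := α)
      (by rw [eH]; exact (ENNReal.ofReal_lt_ofReal_iff hH0).2 hαH)
    obtain ⟨T₂, hlin⟩ := forall_linSolvable_of_lt_omegaHatExp (n := n) (θ := θ) (γ := s⁻¹)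
      (by
        rw [ENNReal.ofReal_inv_of_pos hs0, ← ENNReal.inv_lt_inv, inv_inv, eV]
        exact (ENNReal.ofReal_lt_ofReal_iff hs0).2 hVs)
    have hβ0 : 0 < β := hl0.trans_lt hlβ
    have hmem : ENNReal.ofReal β ≤ lambdaExp n θ := le_sSup ⟨β, hβ0, rfl,
      exists_simSolvable_of_forall_solvable hn0 hindep (hs0.trans hsα) (hαH.trans hH1)
        (inv_pos.2 hs0) (by rwa [inv_inv]) (by rwa [inv_inv]) hsim hlin⟩
    rw [el] at hmem
    exact absurd ((ENNReal.ofReal_le_ofReal_iff hl0).1 hmem) (not_le.2 hlβ)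
  rw [eH, eV, el, ← ENNReal.ofReal_one, ← ENNReal.ofReal_sub _ hV0,
    ← ENNReal.ofReal_sub _ hH0.le, ← ENNReal.ofReal_div_of_pos (sub_pos.2 hH1),
    ← ENNReal.ofReal_div_of_pos hH0]
  refine ENNReal.ofReal_le_ofReal ?_
  rw [div_le_div_iff₀ (sub_pos.2 hH1) hH0]
  linarith
end
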